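/- Let I ⊆ ℝ be an open interval and let c₁, c₂ : I → ℝ be C¹ functions with c₁(z₁) > 0 for all z₁ ∈ I. Define φ(z₁, z₂) := c₁(z₁) / ( c₁(z₁)² + (z₂ + c₂(z₁))² ) on U := I × ℝ. Then φ satisfies the equation ∂φ/∂z₁ = z₁·( (∂φ/∂z₂)³·z₂ + 4φ⁴·(∂φ/∂z₂)·z₂ − 4φ⁵ + 3(∂φ/∂z₂)²·φ ) / ( 4φ⁴z₂² + (∂φ/∂z₂)²z₂² + 4(∂φ/∂z₂)·φ·z₂ + 4φ² ) at every point of U if and only if for all z₁ ∈ I the following three equations hold: (i) z₁c₁ − c₁'c₂² − c₁'c₁² = 0; (ii) −2c₁'c₁²c₂ + 2c₁c₂²c₂' − 2c₁'c₂³ + 2c₁³c₂' + 4z₁c₁c₂ = 0; (iii) −c₁'c₂⁴ + 2c₁c₂³c₂' + 2c₁³c₂c₂' + 3z₁c₁c₂² + c₁⁴c₁' − z₁c₁³ = 0. -/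

import Mathlib

/-- A real quadratic polynomial vanishes identically iff its coefficients vanish. -/
theorem forall_quadratic_eq_zero_iff (p q r : ℝ) :
    (∀ t : ℝ, p * t ^ 2 + q * t + r = 0) ↔ p = 0 ∧ q = 0 ∧ r = 0 := by
  constructor
  · intro h
    have h₀ := h 0
    have h₁ := h 1
    have h₂ := h (-1)
    refine ⟨?_, ?_, ?_⟩ <;> linarith
  · rintro ⟨rfl, rfl, rfl⟩ t
    ring

/-- Closed form of the right-hand side of the characterizing equation, where `F` and `G` are the
values of `φ` and `∂φ/∂z₂`, with `u = c₁`, `v = c₂`, `t = z₂`. -/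
theorem characterizing_rhs_eq (z u v t F G : ℝ) (hu : 0 < u)
    (hF : F = u / (u ^ 2 + (t + v) ^ 2))
    (hG : G = -2 * u * (t + v) / (u ^ 2 + (t + v) ^ 2) ^ 2) :
    z * (G ^ 3 * t + 4 * F ^ 4 * G * t - 4 * F ^ 5 + 3 * G ^ 2 * F) /
        (4 * F ^ 4 * t ^ 2 + G ^ 2 * t ^ 2 + 4 * G * F * t + 4 * F ^ 2) =
      z * u * (t ^ 2 + 4 * t * v + 3 * v ^ 2 - u ^ 2) /
        ((u ^ 2 + (t + v) ^ 2) ^ 2 * (u ^ 2 + v ^ 2)) := by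
  have hD : u ^ 2 + (t + v) ^ 2 ≠ 0 := by positivity
  have hE : u ^ 2 + v ^ 2 ≠ 0 := by positivity
  have hnum : G ^ 3 * t + 4 * F ^ 4 * G * t - 4 * F ^ 5 + 3 * G ^ 2 * F =
      4 * u ^ 3 * (t ^ 2 + 4 * t * v + 3 * v ^ 2 - u ^ 2) / (u ^ 2 + (t + v) ^ 2) ^ 5 := by
    rw [hF, hG]
    field_simp
    ring
  have hden : 4 * F ^ 4 * t ^ 2 + G ^ 2 * t ^ 2 + 4 * G * F * t + 4 * F ^ 2 =
      4 * u ^ 2 * (u ^ 2 + v ^ 2) / (u ^ 2 + (t + v) ^ 2) ^ 3 := by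
    rw [hF, hG]
    field_simp
    ring
  rw [hnum, hden]
  field_simp

/-- The characterizing equation at a point, cleared of denominators, is a quadratic in `t`. -/
theorem characterizing_eq_iff_quadratic (z u v u' v' t : ℝ) (hu : 0 < u) :
    (u' * (u ^ 2 + (t + v) ^ 2) - u * (2 * u * u' + 2 * (t + v) * v')) /
          (u ^ 2 + (t + v) ^ 2) ^ 2 =
        z * u * (t ^ 2 + 4 * t * v + 3 * v ^ 2 - u ^ 2) /
          ((u ^ 2 + (t + v) ^ 2) ^ 2 * (u ^ 2 + v ^ 2)) ↔
      (z * u - u' * v ^ 2 - u' * u ^ 2) * t ^ 2 +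
        (-2 * u' * u ^ 2 * v + 2 * u * v ^ 2 * v' - 2 * u' * v ^ 3 + 2 * u ^ 3 * v' +
          4 * z * u * v) * t +
        (-u' * v ^ 4 + 2 * u * v ^ 3 * v' + 2 * u ^ 3 * v * v' + 3 * z * u * v ^ 2 +
          u ^ 4 * u' - z * u ^ 3) = 0 := by
  have hD : (u ^ 2 + (t + v) ^ 2) ^ 2 ≠ 0 := by positivity
  have hE : u ^ 2 + v ^ 2 ≠ 0 := by positivity
  rw [mul_comm (_ ^ 2) (u ^ 2 + v ^ 2), ← div_div, div_left_inj' hD, eq_div_iff hE,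
    eq_comm, ← sub_eq_zero]
  ring_nf

/-- For φ(z₁,z₂) = c₁(z₁)/(c₁(z₁)² + (z₂+c₂(z₁))²), the characterizing equation
(λ = 1) holds on I × ℝ iff the three ODEs (11) of the paper hold on I. -/
theorem stmt_9 (a b : ℝ) (c₁ c₂ : ℝ → ℝ)
    (hc₁ : ContDiffOn ℝ 1 c₁ (Set.Ioo a b)) (hc₂ : ContDiffOn ℝ 1 c₂ (Set.Ioo a b))
    (hpos : ∀ z ∈ Set.Ioo a b, 0 < c₁ z)
    (φ : ℝ → ℝ → ℝ) (hφ : φ = fun s t => c₁ s / ((c₁ s) ^ 2 + (t + c₂ s) ^ 2)) :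
    (∀ z₁ ∈ Set.Ioo a b, ∀ z₂ : ℝ,
      deriv (fun s => φ s z₂) z₁ =
        z₁ * ((deriv (φ z₁) z₂) ^ 3 * z₂ + 4 * (φ z₁ z₂) ^ 4 * deriv (φ z₁) z₂ * z₂ -
            4 * (φ z₁ z₂) ^ 5 + 3 * (deriv (φ z₁) z₂) ^ 2 * φ z₁ z₂) /
          (4 * (φ z₁ z₂) ^ 4 * z₂ ^ 2 + (deriv (φ z₁) z₂) ^ 2 * z₂ ^ 2 +
            4 * deriv (φ z₁) z₂ * φ z₁ z₂ * z₂ + 4 * (φ z₁ z₂) ^ 2)) ↔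
    (∀ z₁ ∈ Set.Ioo a b,
      z₁ * c₁ z₁ - deriv c₁ z₁ * (c₂ z₁) ^ 2 - deriv c₁ z₁ * (c₁ z₁) ^ 2 = 0 ∧
      -2 * deriv c₁ z₁ * (c₁ z₁) ^ 2 * c₂ z₁ + 2 * c₁ z₁ * (c₂ z₁) ^ 2 * deriv c₂ z₁ -
        2 * deriv c₁ z₁ * (c₂ z₁) ^ 3 + 2 * (c₁ z₁) ^ 3 * deriv c₂ z₁ +
        4 * z₁ * c₁ z₁ * c₂ z₁ = 0 ∧
      -deriv c₁ z₁ * (c₂ z₁) ^ 4 + 2 * c₁ z₁ * (c₂ z₁) ^ 3 * deriv c₂ z₁ +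
        2 * (c₁ z₁) ^ 3 * c₂ z₁ * deriv c₂ z₁ + 3 * z₁ * c₁ z₁ * (c₂ z₁) ^ 2 +
        (c₁ z₁) ^ 4 * deriv c₁ z₁ - z₁ * (c₁ z₁) ^ 3 = 0) := by
  subst hφ
  refine forall₂_congr fun z hz => ?_
  rw [← forall_quadratic_eq_zero_iff]
  refine forall_congr' fun t => ?_
  have hu := hpos z hz
  have hnhds := isOpen_Ioo.mem_nhds hz
  have h₁ := ((hc₁.contDiffAt hnhds).differentiableAt one_ne_zero).hasDerivAt
  have h₂ := ((hc₂.contDiffAt hnhds).differentiableAt one_ne_zero).hasDerivAt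
  have hD : c₁ z ^ 2 + (t + c₂ z) ^ 2 ≠ 0 := by positivity
  have hs : deriv (fun s => c₁ s / (c₁ s ^ 2 + (t + c₂ s) ^ 2)) z =
      (deriv c₁ z * (c₁ z ^ 2 + (t + c₂ z) ^ 2) -
        c₁ z * (2 * c₁ z * deriv c₁ z + 2 * (t + c₂ z) * deriv c₂ z)) /
          (c₁ z ^ 2 + (t + c₂ z) ^ 2) ^ 2 := by
    refine (h₁.fun_div ((h₁.fun_pow 2).fun_add ((h₂.const_add t).fun_pow 2)) hD).deriv.trans ?_
    norm_num
  have ht : deriv (fun t => c₁ z / (c₁ z ^ 2 + (t + c₂ z) ^ 2)) t =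
      -2 * c₁ z * (t + c₂ z) / (c₁ z ^ 2 + (t + c₂ z) ^ 2) ^ 2 := by
    refine ((hasDerivAt_const t (c₁ z)).fun_div
      ((((hasDerivAt_id' t).add_const (c₂ z)).fun_pow 2).const_add (c₁ z ^ 2)) hD).deriv.trans ?_
    congr 1
    norm_num
    ring
  rw [← characterizing_eq_iff_quadratic z _ _ _ _ t hu, ← hs,
    ← characterizing_rhs_eq z (c₁ z) (c₂ z) t _ _ hu rfl ht]
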